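/- If the graph G(φ) associated with a 3-CNF formula φ admits a planar geometric storyplan, then φ has a truth assignment under which every clause of φ contains exactly one true literal. -/

import Mathlib

/-- The straight-line drawing `D` of the subgraph of `G` induced by the visible
vertex set `S` is planar. -/
def IsPlanarSLFrame {V : Type*} (G : SimpleGraph V) (S : Set V) (D : V → ℝ × ℝ) : Prop :=
  Set.InjOn D S ∧
  (∀ u v w, G.Adj u v → u ∈ S → v ∈ S → w ∈ S → w ≠ u → w ≠ v →
      D w ∉ openSegment ℝ (D u) (D v)) ∧
  (∀ u v x y, G.Adj u v → G.Adj x y → u ∈ S → v ∈ S → x ∈ S → y ∈ S →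
      ¬((u = x ∧ v = y) ∨ (u = y ∧ v = x)) →
      ∀ p ∈ segment ℝ (D u) (D v) ∩ segment ℝ (D x) (D y),
        ∃ z, (z = u ∨ z = v) ∧ (z = x ∨ z = y) ∧ p = D z)

/-- `(len, s, e, D)` is a planar geometric storyplan of `G`: `len ≥ 1` time steps,
each vertex `v` is visible on the nonempty interval `[s v, e v] ⊆ [1, len]`,
the endpoints of every edge co-occur, and every frame is a planar
straight-line drawing. -/
def IsGeomStoryplan {V : Type*} (G : SimpleGraph V)
    (len : ℕ) (s e : V → ℕ) (D : V → ℝ × ℝ) : Prop :=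
  1 ≤ len ∧
  (∀ v, 1 ≤ s v ∧ s v ≤ e v ∧ e v ≤ len) ∧
  (∀ u v, G.Adj u v → ∃ t, s u ≤ t ∧ t ≤ e u ∧ s v ≤ t ∧ t ≤ e v) ∧
  (∀ t, 1 ≤ t → t ≤ len → IsPlanarSLFrame G {v | s v ≤ t ∧ t ≤ e v} D)

/-- `G` admits a planar geometric storyplan. -/
def HasGeomStoryplan {V : Type*} (G : SimpleGraph V) : Prop :=
  ∃ len s e D, IsGeomStoryplan G len s e D

/-- Vertices of the graph `G(φ)` for a 3-CNF formula `φ` with `n` variables and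
`m` clauses:
* `varv i b p` — the `p`-th vertex of the v-side of variable `xᵢ`
  (side `b = true` is `Aᵢ`, to which positive occurrences attach;
  side `b = false` is `Bᵢ`);
* `Uv j k u` — the `u`-th vertex of part `U_k` of the `K₂,₂,₂` of clause `Cⱼ`;
* `Sv j k` — the special vertex `s_k` of clause `Cⱼ`;
* `Wv j k w` — the `w`-th vertex of the w-side for the `k`-th literal of `Cⱼ`. -/
inductive PhiVert (n m : ℕ) : Type
  | varv : Fin n → Bool → Fin 3 → PhiVert n m
  | Uv : Fin m → Fin 3 → Fin 2 → PhiVert n m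
  | Sv : Fin m → Fin 3 → PhiVert n m
  | Wv : Fin m → Fin 3 → Fin 3 → PhiVert n m

/-- Base relation generating the edges of `G(φ)`, where `φ j k = (i, b)` means
that the `k`-th literal of clause `Cⱼ` is the variable `xᵢ`, positive if
`b = true` and negative if `b = false`:
* variable gadget: a `K₃,₃` between the two v-sides of each variable;
* clause gadget: a complete tripartite `K₂,₂,₂` on `U₁, U₂, U₃`, the three
  special vertices pairwise adjacent, and `s_k` adjacent to both vertices
  of `U_k`;
* wire gadget: each w-side vertex of the `k`-th literal of `Cⱼ` is adjacent to
  all three vertices of the `k`-th c-side `U_k ∪ {s_k}` of `K(Cⱼ)` and to all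
  three vertices of the v-side `Aᵢ` (if positive) resp. `Bᵢ` (if negative)
  of its variable. -/
def PhiRel {n m : ℕ} (φ : Fin m → Fin 3 → Fin n × Bool) :
    PhiVert n m → PhiVert n m → Prop
  | .varv i b _, .varv i' b' _ => i = i' ∧ b ≠ b'
  | .Uv j k _, .Uv j' k' _ => j = j' ∧ k ≠ k'
  | .Sv j k, .Sv j' k' => j = j' ∧ k ≠ k'
  | .Sv j k, .Uv j' k' _ => j = j' ∧ k = k'
  | .Wv j k _, .Uv j' k' _ => j = j' ∧ k = k'
  | .Wv j k _, .Sv j' k' => j = j' ∧ k = k'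
  | .Wv j k _, .varv i b _ => i = (φ j k).1 ∧ b = (φ j k).2
  | _, _ => False

/-- The graph `G(φ)` associated with the 3-CNF formula `φ`. -/
def PhiGraph {n m : ℕ} (φ : Fin m → Fin 3 → Fin n × Bool) :
    SimpleGraph (PhiVert n m) :=
  SimpleGraph.fromRel (PhiRel φ)

/-! ### Geometry: one-bend drawings of `K₃,₃` are not planar -/

/-- Angle swept when looking from `x` at the segment from `p` to `q`. -/
noncomputable def sweep (x p q : ℂ) : ℝ := Complex.arg ((q - x) / (p - x))

/-- Disjoint segments: there is a functional positive on all differences. -/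
lemma exists_sep (p q r u : ℂ) (h : Disjoint (segment ℝ p q) (segment ℝ r u)) :
    ∃ w : ℂ, ∀ x ∈ segment ℝ p q, ∀ y ∈ segment ℝ r u, 0 < (w * (x - y)).re := by
  have hc : ∀ a b : ℂ, IsCompact (segment ℝ a b) := fun a b => by
    rw [segment_eq_image_lineMap]
    exact isCompact_Icc.image (AffineMap.lineMap_continuous)
  obtain ⟨f, c, d, h1, h2, h3⟩ := geometric_hahn_banach_compact_closed
    (convex_segment r u) (hc r u) (convex_segment p q) (hc p q).isClosed h.symm
  refine ⟨⟨f 1, -f Complex.I⟩, fun x hx y hy => ?_⟩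
  have key : ∀ z : ℂ, ((⟨f 1, -f Complex.I⟩ : ℂ) * z).re = f z := by
    intro z
    have hz : z = z.re • (1 : ℂ) + z.im • Complex.I := by
      apply Complex.ext <;> simp
    conv_rhs => rw [hz, map_add, map_smul, map_smul]
    simp [Complex.mul_re]
    ring
  rw [key, map_sub]
  have := h1 y hy
  have := h3 x hx
  linarith

lemma arg_div_of_re_pos (a b : ℂ) (ha : 0 < a.re) (hb : 0 < b.re) :
    Complex.arg (b / a) = Complex.arg b - Complex.arg a := by
  have ha0 : a ≠ 0 := fun h => by simp [h] at ha
  have hb0 : b ≠ 0 := fun h => by simp [h] at hb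
  have h1 := abs_lt.1 (Complex.abs_arg_lt_pi_div_two_iff.2 (Or.inl ha))
  have h2 := abs_lt.1 (Complex.abs_arg_lt_pi_div_two_iff.2 (Or.inl hb))
  have h3 : ((Complex.arg (b / a) : ℝ) : Real.Angle) =
      ((Complex.arg b - Complex.arg a : ℝ) : Real.Angle) := by
    rw [Complex.arg_div_coe_angle hb0 ha0, Real.Angle.coe_sub]
  have h4 := congrArg Real.Angle.toReal h3
  rwa [Real.Angle.toReal_coe_eq_self_iff.2 ⟨Complex.neg_pi_lt_arg _, Complex.arg_le_pi _⟩,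
    Real.Angle.toReal_coe_eq_self_iff.2 ⟨by linarith, by linarith⟩] at h4

lemma cell (p q r u : ℂ) (h : Disjoint (segment ℝ p q) (segment ℝ r u)) :
    sweep r p q - sweep u p q = sweep p r u - sweep q r u := by
  obtain ⟨w, hw⟩ := exists_sep p q r u h
  have hp := left_mem_segment ℝ p q
  have hq := right_mem_segment ℝ p q
  have hr := left_mem_segment ℝ r u
  have hu := right_mem_segment ℝ r u
  have hw0 : w ≠ 0 := fun h => by simpa [h] using hw p hp r hr
  have e : ∀ a b : ℂ, 0 < (w * a).re → 0 < (w * b).re →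
      Complex.arg (b / a) = Complex.arg (w * b) - Complex.arg (w * a) := by
    intro a b ha hb
    rw [← arg_div_of_re_pos _ _ ha hb, mul_div_mul_left _ _ hw0]
  unfold sweep
  have e1 : (u - p) / (r - p) = (p - u) / (p - r) := by
    rw [← neg_sub p u, ← neg_sub p r, neg_div_neg_eq]
  have e2 : (u - q) / (r - q) = (q - u) / (q - r) := by
    rw [← neg_sub q u, ← neg_sub q r, neg_div_neg_eq]
  rw [e1, e2, e _ _ (hw p hp r hr) (hw q hq r hr), e _ _ (hw p hp u hu) (hw q hq u hu),
    e _ _ (hw p hp r hr) (hw p hp u hu), e _ _ (hw q hq r hr) (hw q hq u hu)]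
  ring

/-- Sweep along a one-bend polyline. -/
noncomputable def sweep2 (x p m q : ℂ) : ℝ := sweep x p m + sweep x m q

/-- One-bend polyline. -/
def poly (p m q : ℂ) : Set ℂ := segment ℝ p m ∪ segment ℝ m q

lemma cell2 (p m q r k u : ℂ) (h : Disjoint (poly p m q) (poly r k u)) :
    sweep2 r p m q - sweep2 u p m q = sweep2 p r k u - sweep2 q r k u := by
  unfold poly at h
  rw [Set.disjoint_union_left, Set.disjoint_union_right, Set.disjoint_union_right] at h
  have h1 := cell _ _ _ _ h.1.1
  have h2 := cell _ _ _ _ h.1.2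
  have h3 := cell _ _ _ _ h.2.1
  have h4 := cell _ _ _ _ h.2.2
  unfold sweep2
  linarith

lemma sweep2_angle (x p m q : ℂ) (hp : p ≠ x) (hm : m ≠ x) (hq : q ≠ x) :
    ((sweep2 x p m q : ℝ) : Real.Angle) =
      (Complex.arg (q - x) : Real.Angle) - (Complex.arg (p - x) : Real.Angle) := by
  have hp := sub_ne_zero.2 hp
  have hm := sub_ne_zero.2 hm
  have hq := sub_ne_zero.2 hq
  unfold sweep2 sweep
  rw [Real.Angle.coe_add, Complex.arg_div_coe_angle hm hp, Complex.arg_div_coe_angle hq hm]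
  abel

/-- A lift of the direction of `P y - P x`, with exact half turn under swapping. -/
noncomputable def lft (P : Fin 3 → ℂ) (x y : Fin 3) : ℝ :=
  if x < y then Complex.arg (P y - P x) else Complex.arg (P x - P y) + Real.pi

lemma lft_angle (P : Fin 3 → ℂ) (x y : Fin 3) (h : P x ≠ P y) :
    ((lft P x y : ℝ) : Real.Angle) = (Complex.arg (P y - P x) : Real.Angle) := by
  unfold lft
  split_ifs
  · rfl
  · rw [Real.Angle.coe_add, ← neg_sub (P x) (P y), Complex.arg_neg_coe_angle (sub_ne_zero.2 h)]

lemma lft_swap (P : Fin 3 → ℂ) (x y : Fin 3) (h : x < y) :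
    lft P x y - lft P y x = -Real.pi := by
  unfold lft
  rw [if_pos h, if_neg (not_lt.2 h.le)]
  ring

lemma left_mem_poly (p m q : ℂ) : p ∈ poly p m q := Or.inl (left_mem_segment ℝ _ _)
lemma mid_mem_poly (p m q : ℂ) : m ∈ poly p m q := Or.inl (right_mem_segment ℝ _ _)
lemma right_mem_poly (p m q : ℂ) : q ∈ poly p m q := Or.inr (right_mem_segment ℝ _ _)

lemma no_planar_K33 (A B : Fin 3 → ℂ) (s : Fin 3 → Fin 3 → ℂ)
    (h : ∀ i i' j j', i ≠ i' → j ≠ j' →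
      Disjoint (poly (A i) (s i j) (B j)) (poly (A i') (s i' j') (B j'))) : False := by
  have ne : ∀ i i' j j', i ≠ i' → j ≠ j' → ∀ x ∈ poly (A i) (s i j) (B j),
      ∀ y ∈ poly (A i') (s i' j') (B j'), x ≠ y := fun i i' j j' h1 h2 x hx y hy =>
    Set.disjoint_iff_forall_ne.1 (h i i' j j' h1 h2) hx hy
  have ex3 : ∀ j : Fin 3, ∃ j', j ≠ j' := by decide
  have hA : ∀ i' i j, ∃ n : ℤ, i ≠ i' → sweep2 (A i') (A i) (s i j) (B j) =
      Complex.arg (B j - A i') - lft A i' i + 2 * Real.pi * n := by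
    intro i' i j
    by_cases hi : i = i'
    · exact ⟨0, fun h => absurd hi h⟩
    obtain ⟨j', hj⟩ := ex3 j
    have n0 := ne i i' j j' hi hj
    have n1 := n0 _ (left_mem_poly _ _ _) _ (left_mem_poly _ _ _)
    have n2 := n0 _ (mid_mem_poly _ _ _) _ (left_mem_poly _ _ _)
    have n3 := n0 _ (right_mem_poly _ _ _) _ (left_mem_poly _ _ _)
    have := sweep2_angle _ _ _ _ n1 n2 n3
    rw [← lft_angle A i' i n1.symm, ← Real.Angle.coe_sub, Real.Angle.angle_eq_iff_two_pi_dvd_sub]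
      at this
    obtain ⟨n, hn⟩ := this
    exact ⟨n, fun _ => by linarith⟩
  have hB : ∀ j' i j, ∃ n : ℤ, j ≠ j' → sweep2 (B j') (A i) (s i j) (B j) =
      lft B j' j - (Complex.arg (B j' - A i) + Real.pi) + 2 * Real.pi * n := by
    intro j' i j
    by_cases hj : j = j'
    · exact ⟨0, fun h => absurd hj h⟩
    obtain ⟨i', hi⟩ := ex3 i
    have n0 := ne i i' j j' hi hj
    have n1 := n0 _ (left_mem_poly _ _ _) _ (right_mem_poly _ _ _)
    have n2 := n0 _ (mid_mem_poly _ _ _) _ (right_mem_poly _ _ _)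
    have n3 := n0 _ (right_mem_poly _ _ _) _ (right_mem_poly _ _ _)
    have := sweep2_angle _ _ _ _ n1 n2 n3
    rw [← lft_angle B j' j n3.symm, ← neg_sub (B j') (A i),
      Complex.arg_neg_coe_angle (sub_ne_zero.2 n1.symm), ← Real.Angle.coe_add,
      ← Real.Angle.coe_sub, Real.Angle.angle_eq_iff_two_pi_dvd_sub] at this
    obtain ⟨n, hn⟩ := this
    exact ⟨n, fun _ => by linarith⟩
  choose a ha using hA
  choose b hb using hB
  have key : ∀ i i' j j', i ≠ i' → j ≠ j' →
      2 * Real.pi * ((a i' i j - b j' i j - a i i' j' + b j i' j' : ℤ) : ℝ) =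
        - ((lft A i i' - lft A i' i) + (lft B j j' - lft B j' j)) := by
    intro i i' j j' hi hj
    have hc := cell2 _ _ _ _ _ _ (h i i' j j' hi hj)
    rw [ha i' i j hi, hb j' i j hj, ha i i' j' hi.symm, hb j i' j' hj.symm] at hc
    push_cast
    linarith
  have k1 : ∀ i i' j j', i < i' → j < j' → a i' i j - b j' i j - a i i' j' + b j i' j' = 1 := by
    intro i i' j j' hi hj
    have := key i i' j j' hi.ne hj.ne
    rw [lft_swap A i i' hi, lft_swap B j j' hj] at this
    have h2 : 2 * Real.pi * (((a i' i j - b j' i j - a i i' j' + b j i' j' : ℤ) : ℝ) - 1) = 0 := by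
      linarith
    have h3 := (mul_eq_zero.1 h2).resolve_left (by positivity)
    have h4 := sub_eq_zero.1 h3
    exact_mod_cast h4
  have k2 : ∀ i i' j j', i < i' → j < j' → a i' i j' - b j i j' - a i i' j + b j' i' j = 0 := by
    intro i i' j j' hi hj
    have := key i i' j' j hi.ne hj.ne'
    have hs := lft_swap B j j' hj
    rw [lft_swap A i i' hi] at this
    have h2 : 2 * Real.pi * ((a i' i j' - b j i j' - a i i' j + b j' i' j : ℤ) : ℝ) = 0 := by
      linarith
    have h3 := (mul_eq_zero.1 h2).resolve_left (by positivity)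
    exact_mod_cast h3
  have l01 : (0 : Fin 3) < 1 := by decide
  have l02 : (0 : Fin 3) < 2 := by decide
  have l12 : (1 : Fin 3) < 2 := by decide
  have t : ∀ j j', j < j' → _ := fun j j' hj =>
    And.intro (And.intro (k1 0 1 j j' l01 hj) (k2 0 1 j j' l01 hj))
      (And.intro (And.intro (k1 0 2 j j' l02 hj) (k2 0 2 j j' l02 hj))
        (And.intro (k1 1 2 j j' l12 hj) (k2 1 2 j j' l12 hj)))
  have t1 := t 0 1 l01
  have t2 := t 0 2 l02
  have t3 := t 1 2 l12
  omega

/-! ### Frames -/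

lemma frame_no_K33 {V : Type*} (G : SimpleGraph V) (S : Set V) (D : V → ℝ × ℝ)
    (hF : IsPlanarSLFrame G S D) (a b : Fin 3 → V) (σ : Fin 3 → Fin 3 → V)
    (ha : ∀ i, a i ∈ S) (hb : ∀ j, b j ∈ S) (hs : ∀ i j, σ i j ∈ S)
    (h1 : ∀ i j, a i = σ i j ∨ G.Adj (a i) (σ i j)) (h2 : ∀ i j, G.Adj (σ i j) (b j))
    (hd : ∀ i i' j j', i ≠ i' → j ≠ j' → ∀ z, (z = a i ∨ z = σ i j ∨ z = b j) →
      (z = a i' ∨ z = σ i' j' ∨ z = b j') → False) : False := by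
  let L := Complex.equivRealProdCLM.symm
  have hL : ∀ p q : ℝ × ℝ, segment ℝ (L p) (L q) = L '' segment ℝ p q := fun p q =>
    (image_segment ℝ (L : ℝ × ℝ →L[ℝ] ℂ).toLinearMap.toAffineMap p q).symm
  have sub : ∀ i j, ∀ z ∈ poly (L (D (a i))) (L (D (σ i j))) (L (D (b j))),
      ∃ u v, G.Adj u v ∧ (u = a i ∨ u = σ i j ∨ u = b j) ∧ (v = a i ∨ v = σ i j ∨ v = b j) ∧
        ∃ p ∈ segment ℝ (D u) (D v), L p = z := by
    intro i j z hz
    rcases hz with hz | hz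
    · rcases h1 i j with h | h
      · rw [h, segment_same] at hz
        refine ⟨σ i j, b j, h2 i j, by tauto, by tauto, D (σ i j), left_mem_segment ℝ _ _, hz.symm⟩
      · rw [hL] at hz
        exact ⟨a i, σ i j, h, by tauto, by tauto, hz⟩
    · rw [hL] at hz
      exact ⟨σ i j, b j, h2 i j, by tauto, by tauto, hz⟩
  have mem : ∀ i j u, (u = a i ∨ u = σ i j ∨ u = b j) → u ∈ S := by
    rintro i j u (rfl | rfl | rfl)
    · exact ha i
    · exact hs i j
    · exact hb j
  refine no_planar_K33 (fun i => L (D (a i))) (fun j => L (D (b j))) (fun i j => L (D (σ i j))) ?_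
  intro i i' j j' hi hj
  rw [Set.disjoint_left]
  intro z hz hz'
  obtain ⟨u, v, huv, hu, hv, p, hp, rfl⟩ := sub i j z hz
  obtain ⟨x, y, hxy, hx, hy, p', hp', hpp⟩ := sub i' j' _ hz'
  obtain rfl := L.injective hpp
  have hdd := hd i i' j j' hi hj
  obtain ⟨w, hw, hw', -⟩ := hF.2.2 u v x y huv hxy (mem _ _ _ hu) (mem _ _ _ hv) (mem _ _ _ hx)
    (mem _ _ _ hy) (by
      rintro (⟨rfl, -⟩ | ⟨rfl, -⟩)
      · exact hdd _ hu hx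
      · exact hdd _ hu hy) p' ⟨hp, hp'⟩
  refine hdd w ?_ ?_
  · rcases hw with rfl | rfl <;> assumption
  · rcases hw' with rfl | rfl <;> assumption

/-! ### Intervals -/

/-- The visibility intervals of `u` and `v` intersect. -/
def Meet {V : Type*} (s e : V → ℕ) (u v : V) : Prop := s u ≤ e v ∧ s v ≤ e u

/-- All vertices of a side pairwise co-occur. -/
def PMeet {V : Type*} (s e : V → ℕ) (X : Fin 3 → V) : Prop := ∀ i j, Meet s e (X i) (X j)

lemma helly {V ι : Type*} [Finite ι] [Nonempty ι] (s e : V → ℕ) (f : ι → V)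
    (h : ∀ i j, Meet s e (f i) (f j)) :
    ∃ i₀ j₀, ∀ i, s (f i) ≤ s (f i₀) ∧ e (f j₀) ≤ e (f i) := by
  obtain ⟨i₀, hi⟩ := Finite.exists_max (fun i => s (f i))
  obtain ⟨j₀, hj⟩ := Finite.exists_min (fun i => e (f i))
  exact ⟨i₀, j₀, fun i => ⟨hi i, hj i⟩⟩

section Story

variable {V : Type*} {G : SimpleGraph V} {len : ℕ} {s e : V → ℕ} {D : V → ℝ × ℝ}

lemma meet_of_adj (h : IsGeomStoryplan G len s e D) {u v : V} (huv : G.Adj u v) :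
    Meet s e u v := by
  obtain ⟨t, h1, h2, h3, h4⟩ := h.2.2.1 u v huv
  exact ⟨by omega, by omega⟩

lemma frame_at (h : IsGeomStoryplan G len s e D) (v : V) (t : ℕ) (h1 : s v ≤ t) (h2 : t ≤ e v) :
    IsPlanarSLFrame G {v | s v ≤ t ∧ t ≤ e v} D := by
  have := h.2.1 v
  exact h.2.2.2 t (by omega) (by omega)

lemma K33_iff (h : IsGeomStoryplan G len s e D) (X Y : Fin 3 → V)
    (hX : Function.Injective X) (hY : Function.Injective Y)
    (hXY : ∀ i j, G.Adj (X i) (Y j)) : PMeet s e X ↔ ¬ PMeet s e Y := by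
  have hm := fun i j => meet_of_adj h (hXY i j)
  constructor
  · intro hPX hPY
    let f : Fin 3 ⊕ Fin 3 → V := Sum.elim X Y
    have hf : ∀ i j, Meet s e (f i) (f j) := by
      rintro (i | i) (j | j)
      · exact hPX i j
      · exact hm i j
      · exact (hm j i).symm
      · exact hPY i j
    obtain ⟨i₀, _, hi⟩ := helly s e f hf
    have hv : ∀ i, s (f i) ≤ s (f i₀) ∧ s (f i₀) ≤ e (f i) := fun i => ⟨(hi i).1, (hf i₀ i).1⟩
    have hF := frame_at h (f i₀) _ (hv i₀).1 (hv i₀).2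
    refine frame_no_K33 G _ D hF X Y (fun i _ => X i) (fun i => hv (.inl i)) (fun i => hv (.inr i))
      (fun i _ => hv (.inl i)) (fun _ _ => Or.inl rfl) hXY ?_
    intro i i' j j' hi hj z hz hz'
    have n1 := hX.ne hi
    have n2 := hY.ne hj
    have n3 := (hXY i j').ne
    have n4 := (hXY i' j).ne
    rcases hz with rfl | rfl | rfl <;> rcases hz' with h | h | h <;>
      first | exact n1 h | exact n2 h | exact n3 h | exact n4 h.symm
  · intro hPY
    by_contra hPX
    unfold PMeet at hPX hPY
    push Not at hPX hPY
    obtain ⟨x, x', hx⟩ := hPX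
    obtain ⟨y, y', hy⟩ := hPY
    have a1 := hm x y
    have a2 := hm x y'
    have a3 := hm x' y
    have a4 := hm x' y'
    unfold Meet at *
    omega

end Story

/-! ### The reduction -/

section Red

variable {n m : ℕ} {φ : Fin m → Fin 3 → Fin n × Bool} {len : ℕ} {s e : PhiVert n m → ℕ}
  {D : PhiVert n m → ℝ × ℝ}

/-- The c-side. -/
def cside (n : ℕ) {m : ℕ} (j : Fin m) (k : Fin 3) : Fin 3 → PhiVert n m :=
  ![.Uv j k 0, .Uv j k 1, .Sv j k]

lemma adj_var (φ : Fin m → Fin 3 → Fin n × Bool) (i : Fin n) (p q : Fin 3) :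
    (PhiGraph φ).Adj (.varv i true p) (.varv i false q) := by
  simp [PhiGraph, PhiRel, SimpleGraph.fromRel_adj]

lemma adj_wv (φ : Fin m → Fin 3 → Fin n × Bool) (j : Fin m) (k p q : Fin 3) :
    (PhiGraph φ).Adj (.Wv j k p) (.varv (φ j k).1 (φ j k).2 q) := by
  simp [PhiGraph, PhiRel, SimpleGraph.fromRel_adj]

lemma adj_wc (φ : Fin m → Fin 3 → Fin n × Bool) (j : Fin m) (k p q : Fin 3) :
    (PhiGraph φ).Adj (.Wv j k p) (cside n j k q) := by
  fin_cases q <;> simp [cside, PhiGraph, PhiRel, SimpleGraph.fromRel_adj]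

lemma adj_uu (φ : Fin m → Fin 3 → Fin n × Bool) (j : Fin m) (k k' : Fin 3) (p q : Fin 2)
    (h : k ≠ k') : (PhiGraph φ).Adj (.Uv j k p) (.Uv j k' q) := by
  simp [PhiGraph, PhiRel, SimpleGraph.fromRel_adj, h]

lemma adj_ss (φ : Fin m → Fin 3 → Fin n × Bool) (j : Fin m) (k k' : Fin 3)
    (h : k ≠ k') : (PhiGraph φ).Adj (.Sv j k) (.Sv j k') := by
  simp [PhiGraph, PhiRel, SimpleGraph.fromRel_adj, h]

lemma adj_su (φ : Fin m → Fin 3 → Fin n × Bool) (j : Fin m) (k : Fin 3) (p : Fin 2) :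
    (PhiGraph φ).Adj (.Sv j k) (.Uv j k p) := by
  simp [PhiGraph, PhiRel, SimpleGraph.fromRel_adj]

lemma cside_inj (j : Fin m) (k : Fin 3) : Function.Injective (cside n j k) := by
  intro p q h
  fin_cases p <;> fin_cases q <;> simp [cside] at h ⊢

lemma side_transfer (h : IsGeomStoryplan (PhiGraph φ) len s e D) (j : Fin m) (k : Fin 3) :
    PMeet s e (cside n j k) ↔
      PMeet s e (fun q => PhiVert.varv (φ j k).1 (φ j k).2 q) := by
  have hW : Function.Injective (fun p => (PhiVert.Wv j k p : PhiVert n m)) := by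
    intro p q hh
    simpa using hh
  have hV : Function.Injective
      (fun p => (PhiVert.varv (φ j k).1 (φ j k).2 p : PhiVert n m)) := by
    intro p q hh
    simpa using hh
  have h1 := K33_iff h _ _ hW hV (adj_wv φ j k)
  have h2 := K33_iff h _ _ hW (cside_inj j k) (adj_wc φ j k)
  tauto

lemma var_sides (h : IsGeomStoryplan (PhiGraph φ) len s e D) (i : Fin n) :
    PMeet s e (fun q => (PhiVert.varv i true q : PhiVert n m)) ↔
      ¬ PMeet s e (fun q => (PhiVert.varv i false q : PhiVert n m)) :=
  K33_iff h _ _ (fun p q hh => by simpa using hh) (fun p q hh => by simpa using hh) (adj_var φ i)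

/-- A non-co-occurring c-side has its two `U`-vertices disjoint. -/
lemma cside_not (h : IsGeomStoryplan (PhiGraph φ) len s e D) (j : Fin m) (k : Fin 3)
    (hc : Meet s e (.Uv j k 0) (.Uv j k 1)) : PMeet s e (cside n j k) := by
  have a0 := meet_of_adj h (adj_su φ j k 0)
  have a1 := meet_of_adj h (adj_su φ j k 1)
  have w := fun v => (h.2.1 v).2.1
  have w0 := w (.Uv j k 0)
  have w1 := w (.Uv j k 1)
  have w2 := w (.Sv j k)
  intro p q
  fin_cases p <;> fin_cases q <;> simp only [cside, Meet] at * <;> simp <;> omega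

lemma clause_at_most (h : IsGeomStoryplan (PhiGraph φ) len s e D) (j : Fin m) (k k' : Fin 3)
    (h1 : ¬ PMeet s e (cside n j k)) (h2 : ¬ PMeet s e (cside n j k')) : k = k' := by
  by_contra hk
  have b1 : ¬ Meet s e (.Uv j k 0) (.Uv j k 1) := fun hc => h1 (cside_not h j k hc)
  have b2 : ¬ Meet s e (.Uv j k' 0) (.Uv j k' 1) := fun hc => h2 (cside_not h j k' hc)
  have m := fun p q => meet_of_adj h (adj_uu φ j k k' p q hk)
  have m1 := m 0 0
  have m2 := m 0 1
  have m3 := m 1 0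
  have m4 := m 1 1
  unfold Meet at *
  omega

/-- Octahedron plus a special vertex cannot be visible at the same time. -/
lemma octa_false (h : IsGeomStoryplan (PhiGraph φ) len s e D) (j : Fin m) (k : Fin 3) (t : ℕ)
    (hS : s (.Sv j k) ≤ t ∧ t ≤ e (.Sv j k))
    (hU : ∀ k' u, s (.Uv j k' u) ≤ t ∧ t ≤ e (.Uv j k' u)) : False := by
  have hF := frame_at h _ t hS.1 hS.2
  have : ∀ k : Fin 3, ∃ k1 k2, k ≠ k1 ∧ k ≠ k2 ∧ k1 ≠ k2 := by decide
  obtain ⟨k1, k2, d1, d2, d3⟩ := this k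
  let a : Fin 3 → PhiVert n m := ![.Uv j k 0, .Uv j k1 0, .Uv j k1 1]
  let b : Fin 3 → PhiVert n m := ![.Uv j k 1, .Uv j k2 0, .Uv j k2 1]
  let σ : Fin 3 → Fin 3 → PhiVert n m :=
    ![![.Sv j k, .Uv j k 0, .Uv j k 0], ![.Uv j k1 0, .Uv j k1 0, .Uv j k1 0],
      ![.Uv j k1 1, .Uv j k1 1, .Uv j k1 1]]
  refine frame_no_K33 _ _ D hF a b σ ?_ ?_ ?_ ?_ ?_ ?_
  · intro i
    fin_cases i <;> exact hU _ _
  · intro i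
    fin_cases i <;> exact hU _ _
  · intro i l
    fin_cases i <;> fin_cases l <;> first | exact hU _ _ | exact hS
  · intro i l
    fin_cases i <;> fin_cases l <;> first | exact Or.inl rfl | exact Or.inr (adj_su φ j k 0).symm
  · intro i l
    fin_cases i <;> fin_cases l <;>
      first
      | exact adj_su φ j k 1
      | exact adj_uu φ j _ _ _ _ d1.symm
      | exact adj_uu φ j _ _ _ _ d2
      | exact adj_uu φ j _ _ _ _ d3
  · intro i i' l l' hi hl z hz hz'
    fin_cases i <;> fin_cases i' <;> first | exact absurd rfl hi | skip
    all_goals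
      fin_cases l <;> fin_cases l' <;> first | exact absurd rfl hl | skip
    all_goals
      simp [a, b, σ] at hz hz'
      rcases hz with rfl | rfl | rfl <;> simp [d1, d2, d3, d1.symm, d2.symm, d3.symm] at hz'

lemma clause_exists (h : IsGeomStoryplan (PhiGraph φ) len s e D) (j : Fin m) :
    ∃ k, ¬ PMeet s e (cside n j k) := by
  by_contra hne
  push Not at hne
  have w := fun v => (h.2.1 v).2.1
  let f : Fin 3 × Fin 2 → PhiVert n m := fun x => .Uv j x.1 x.2
  have hf : ∀ x y, Meet s e (f x) (f y) := by
    rintro ⟨k, u⟩ ⟨k', u'⟩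
    by_cases hk : k = k'
    · subst hk
      have h01 : Meet s e (.Uv j k 0) (.Uv j k 1) := hne k 0 1
      fin_cases u <;> fin_cases u'
      · exact ⟨w _, w _⟩
      · exact h01
      · exact h01.symm
      · exact ⟨w _, w _⟩
    · exact meet_of_adj h (adj_uu φ j k k' u u' hk)
  let g : Fin 3 → PhiVert n m := fun k => .Sv j k
  have hg : ∀ x y, Meet s e (g x) (g y) := by
    intro k k'
    by_cases hk : k = k'
    · subst hk
      exact ⟨w _, w _⟩
    · exact meet_of_adj h (adj_ss φ j k k' hk)
  obtain ⟨x, y, hxy⟩ := helly s e f hf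
  obtain ⟨z, _, hz⟩ := helly s e g hg
  have hz' : ∀ k, s (g k) ≤ s (g z) ∧ s (g z) ≤ e (g k) := fun k => ⟨(hz k).1, (hg z k).1⟩
  have hLR : s (f x) ≤ e (f y) := (hf x y).1
  have fin : ∀ k t, s (f x) ≤ t → t ≤ e (f y) → s (g k) ≤ t → t ≤ e (g k) → False := by
    intro k t t1 t2 t3 t4
    refine octa_false h j k t ⟨t3, t4⟩ fun k' u => ?_
    have := hxy (k', u)
    exact ⟨this.1.trans t1, t2.trans this.2⟩
  have m1 : Meet s e (g x.1) (f x) := meet_of_adj h (adj_su φ j x.1 x.2)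
  have m2 : Meet s e (g y.1) (f y) := meet_of_adj h (adj_su φ j y.1 y.2)
  have c1 := hz' x.1
  have c2 := hz' y.1
  unfold Meet at m1 m2
  rcases lt_or_ge (s (g z)) (s (f x)) with hlt | hge
  · exact fin x.1 (s (f x)) le_rfl hLR (by omega) (by omega)
  rcases lt_or_ge (e (f y)) (s (g z)) with hlt' | hge'
  · exact fin y.1 (e (f y)) hLR le_rfl (by omega) (by omega)
  · exact fin z (s (g z)) hge hge' le_rfl (w _)

end Red

/-- If `G(φ)` admits a planar geometric storyplan, then the
3-CNF formula `φ` has a truth assignment `τ` under which every clause contains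
exactly one true literal. (The literal `φ j k = (i, b)` is true under `τ`
iff `τ i = b`.) -/
theorem geom_storyplan_implies_one_in_three_sat
    (n m : ℕ) (φ : Fin m → Fin 3 → Fin n × Bool)
    (hSP : HasGeomStoryplan (PhiGraph φ)) :
    ∃ τ : Fin n → Bool, ∀ j : Fin m, ∃! k : Fin 3, τ (φ j k).1 = (φ j k).2 := by
  classical
  obtain ⟨len, s, e, D, h⟩ := hSP
  refine ⟨fun i => decide (¬ PMeet s e (fun q => (PhiVert.varv i true q : PhiVert n m))),
    fun j => ?_⟩
  have key : ∀ k, (decide (¬ PMeet s e (fun q => (PhiVert.varv (φ j k).1 true q : PhiVert n m))) =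
      (φ j k).2) ↔ ¬ PMeet s e (cside n j k) := by
    intro k
    rw [side_transfer h j k]
    have hv := var_sides h (φ j k).1
    cases hb : (φ j k).2
    · rw [decide_eq_false_iff_not]
      tauto
    · rw [decide_eq_true_iff]
  obtain ⟨k, hk⟩ := clause_exists h j
  exact ⟨k, (key k).2 hk, fun k' hk' => clause_at_most h j k' k ((key k').1 hk') hk⟩
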